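/- arXiv:1108.5603 — 4 statements merged into one kernel-verified Lean document; each statement's English description precedes it below -/
import Mathlib

section
/- Let n ≥ 5 be odd, let s be an integer with 2 ≤ s ≤ 2^(n−1), and set ℓ = (n−1)/2. Suppose 𝓐 is a family of subsets of [n] satisfying [n]^(≥ℓ+1) \ {[n−ℓ, n]} ⊆ 𝓐 and [n−ℓ, n] ∉ 𝓐, and that there exist A, A' ∈ 𝓐 with |A| = |A'| = ℓ, n ∉ A, n ∉ A' and A ∩ A' = ∅. Then there exists a (U,v,f)-compression C such that |𝕀^(s)(C(𝓐))| > |𝕀^(s)(𝓐)|. -/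
open Finset

/-- The ground set `[n] = {1, …, n}`. -/
def groundSet (n : ℕ) : Finset ℕ := Finset.Icc 1 n

/-- All subsets of `[n]`. -/
def allFams (n : ℕ) : Finset (Finset ℕ) := (groundSet n).powerset

/-- `[n]^(≥ r)`: subsets of `[n]` of size at least `r`. -/
def layerGE (n r : ℕ) : Finset (Finset ℕ) := (allFams n).filter fun A => r ≤ A.card

/-- `[n]^(r)`: subsets of `[n]` of size exactly `r`. -/
def layerEQ (n r : ℕ) : Finset (Finset ℕ) := (groundSet n).powersetCard r

/-- `𝕀^(s)(𝓐)`: the intersecting subfamilies of `𝓐` of size `s`. -/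
def interFams (s : ℕ) (𝓐 : Finset (Finset ℕ)) : Finset (Finset (Finset ℕ)) :=
  (𝓐.powersetCard s).filter fun 𝓔 => ∀ B ∈ 𝓔, ∀ B' ∈ 𝓔, (B ∩ B').Nonempty

/-- The `(U,v,f)`-compression of a single set `A` (with `v ∉ A`):
`C(A) = (A \ U) ∪ {v} ∪ f(A ∩ U)`. -/
def cSet (U : Finset ℕ) (v : ℕ) (f : ℕ → ℕ) (A : Finset ℕ) : Finset ℕ :=
  (A \ U) ∪ {v} ∪ (A ∩ U).image f

/-- The `(U,v,f)`-compression of a family: each `A ∈ 𝓐` with `v ∉ A` is replaced by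
`cSet U v f A` provided this set is not already in `𝓐`. -/
def cFam (U : Finset ℕ) (v : ℕ) (f : ℕ → ℕ) (𝓐 : Finset (Finset ℕ)) :
    Finset (Finset ℕ) :=
  𝓐.image fun A => if v ∉ A ∧ cSet U v f A ∉ 𝓐 then cSet U v f A else A

/-- The data of a valid `(U,v,f)`-compression on `[n]`. -/
def IsUVF (n : ℕ) (U : Finset ℕ) (v : ℕ) (f : ℕ → ℕ) : Prop :=
  U ⊆ Finset.Icc 1 n ∧ Even U.card ∧ v ∈ Finset.Icc 1 n ∧ v ∉ U ∧
    (∀ x ∈ U, f x ∈ U) ∧ (∀ x ∈ U, f (f x) = x) ∧ ∀ x ∈ U, f x ≠ x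

section Compression

variable {U : Finset ℕ} {v : ℕ} {f : ℕ → ℕ}

theorem mem_cSet {X : Finset ℕ} {x : ℕ} :
    x ∈ cSet U v f X ↔ (x ∈ X ∧ x ∉ U) ∨ x = v ∨ ∃ y, (y ∈ X ∧ y ∈ U) ∧ f y = x := by
  simp only [cSet, mem_union, mem_sdiff, mem_singleton, mem_image, mem_inter, or_assoc]

theorem point_mem_cSet (X : Finset ℕ) : v ∈ cSet U v f X :=
  mem_cSet.2 (Or.inr (Or.inl rfl))

theorem cSet_subset_of_cSet_eq (hv : v ∉ U) (hfU : ∀ x ∈ U, f x ∈ U)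
    (hff : ∀ x ∈ U, f (f x) = x) {X Y : Finset ℕ} (hX : v ∉ X)
    (h : cSet U v f X = cSet U v f Y) : X ⊆ Y := by
  intro x hx
  by_cases hxU : x ∈ U
  · have hfx : f x ∈ cSet U v f Y := h ▸ mem_cSet.2 (Or.inr (Or.inr ⟨x, ⟨hx, hxU⟩, rfl⟩))
    rcases mem_cSet.1 hfx with h1 | h1 | ⟨y, ⟨hy, hyU⟩, hxy⟩
    · exact absurd (hfU x hxU) h1.2
    · exact absurd (h1 ▸ hfU x hxU) hv
    · rwa [← hff x hxU, ← hxy, hff y hyU]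
  · have hx' : x ∈ cSet U v f Y := h ▸ mem_cSet.2 (Or.inl ⟨hx, hxU⟩)
    rcases mem_cSet.1 hx' with h1 | h1 | ⟨y, ⟨hy, hyU⟩, hxy⟩
    · exact h1.1
    · exact absurd (h1 ▸ hx) hX
    · exact absurd (hxy ▸ hfU y hyU) hxU

theorem cSet_injOn (hv : v ∉ U) (hfU : ∀ x ∈ U, f x ∈ U) (hff : ∀ x ∈ U, f (f x) = x)
    {X Y : Finset ℕ} (hX : v ∉ X) (hY : v ∉ Y) (h : cSet U v f X = cSet U v f Y) : X = Y :=
  (cSet_subset_of_cSet_eq hv hfU hff hX h).antisymm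
    (cSet_subset_of_cSet_eq hv hfU hff hY h.symm)

theorem disjoint_cSet_right (hfU : ∀ x ∈ U, f x ∈ U) (hff : ∀ x ∈ U, f (f x) = x)
    {X Y : Finset ℕ} (hX : v ∉ X) (h : Disjoint (cSet U v f X) Y) :
    Disjoint X (cSet U v f Y) := by
  rw [Finset.disjoint_left] at h ⊢
  intro x hx hxY
  rcases mem_cSet.1 hxY with h1 | h1 | ⟨y, ⟨hy, hyU⟩, rfl⟩
  · exact h (mem_cSet.2 (Or.inl ⟨hx, h1.2⟩)) h1.1
  · exact hX (h1 ▸ hx)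
  · exact h (mem_cSet.2 (Or.inr (Or.inr ⟨f y, ⟨hx, hfU y hyU⟩, hff y hyU⟩))) hy

theorem card_cSet (hv : v ∉ U) (hfU : ∀ x ∈ U, f x ∈ U) (hff : ∀ x ∈ U, f (f x) = x)
    {X : Finset ℕ} (hX : v ∉ X) : (cSet U v f X).card = X.card + 1 := by
  have himg : ((X ∩ U).image f).card = (X ∩ U).card := by
    refine card_image_of_injOn fun x hx y hy hxy => ?_
    rw [← hff x (mem_inter.1 hx).2, hxy, hff y (mem_inter.1 hy).2]
  have hsub : (X ∩ U).image f ⊆ U :=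
    image_subset_iff.2 fun x hx => hfU x (mem_inter.1 hx).2
  rw [cSet, card_union_of_disjoint, card_union_of_disjoint, himg, card_singleton,
    ← card_sdiff_add_card_inter X U]
  · omega
  · simp [hX]
  · rw [Finset.disjoint_left]
    intro x hx hx'
    have hxU := hsub hx'
    rcases mem_union.1 hx with h | h
    · exact (mem_sdiff.1 h).2 hxU
    · exact hv (mem_singleton.1 h ▸ hxU)

theorem cSet_mem_allFams {n : ℕ} (hU : U ⊆ Finset.Icc 1 n) (hvn : v ∈ Finset.Icc 1 n)
    (hfU : ∀ x ∈ U, f x ∈ U) {X : Finset ℕ} (hX : X ∈ allFams n) :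
    cSet U v f X ∈ allFams n := by
  refine mem_powerset.2 fun x hx => ?_
  rcases mem_cSet.1 hx with h1 | rfl | ⟨y, ⟨hy, hyU⟩, rfl⟩
  · exact mem_powerset.1 hX h1.1
  · exact hvn
  · exact hU (hfU y hyU)

variable {𝓐 : Finset (Finset ℕ)}

theorem mem_cFam_of_mem {X : Finset ℕ} (hX : X ∈ 𝓐) (h : v ∉ X → cSet U v f X ∈ 𝓐) :
    X ∈ cFam U v f 𝓐 :=
  mem_image.2 ⟨X, hX, if_neg fun h' => h'.2 (h h'.1)⟩

theorem cSet_mem_cFam {X : Finset ℕ} (hX : X ∈ 𝓐) (hv : v ∉ X) :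
    cSet U v f X ∈ cFam U v f 𝓐 := by
  by_cases h : cSet U v f X ∈ 𝓐
  · exact mem_cFam_of_mem h fun h' => absurd (point_mem_cSet X) h'
  · exact mem_image.2 ⟨X, hX, if_pos ⟨hv, h⟩⟩

/-- The members of `𝓔` which must be compressed when `𝓔 ⊆ 𝓐` is transported to an
intersecting subfamily of the compression of `𝓐`. -/
inductive Moves (U : Finset ℕ) (v : ℕ) (f : ℕ → ℕ) (𝓐 𝓔 : Finset (Finset ℕ)) :
    Finset ℕ → Prop
  | base {X : Finset ℕ} : X ∈ 𝓔 → v ∉ X → cSet U v f X ∉ 𝓐 → Moves U v f 𝓐 𝓔 X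
  | step {X Y : Finset ℕ} : Moves U v f 𝓐 𝓔 Y → X ∈ 𝓔 → v ∉ X →
      Disjoint (cSet U v f X) Y → Moves U v f 𝓐 𝓔 X

theorem Moves.mem {𝓔 : Finset (Finset ℕ)} {X : Finset ℕ} (h : Moves U v f 𝓐 𝓔 X) :
    X ∈ 𝓔 := by
  cases h <;> assumption

theorem Moves.notMem {𝓔 : Finset (Finset ℕ)} {X : Finset ℕ} (h : Moves U v f 𝓐 𝓔 X) :
    v ∉ X := by
  cases h <;> assumption

theorem mem_interFams {s : ℕ} {𝓔 : Finset (Finset ℕ)} :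
    𝓔 ∈ interFams s 𝓐 ↔
      (𝓔 ⊆ 𝓐 ∧ 𝓔.card = s) ∧ ∀ B ∈ 𝓔, ∀ B' ∈ 𝓔, (B ∩ B').Nonempty := by
  rw [interFams, mem_filter, mem_powersetCard]

theorem not_disjoint_of_mem_interFams {s : ℕ} {𝓔 : Finset (Finset ℕ)}
    (h𝓔 : 𝓔 ∈ interFams s 𝓐) {X Y : Finset ℕ} (hX : X ∈ 𝓔) (hY : Y ∈ 𝓔) :
    ¬ Disjoint X Y :=
  not_disjoint_iff_nonempty_inter.2 ((mem_interFams.1 h𝓔).2 X hX Y hY)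

theorem Moves.cSet_notMem {s : ℕ} {𝓔 : Finset (Finset ℕ)} (h𝓔 : 𝓔 ∈ interFams s 𝓐)
    {X : Finset ℕ} (h : Moves U v f 𝓐 𝓔 X) : cSet U v f X ∉ 𝓔 := by
  intro hmem
  cases h with
  | base _ _ h3 => exact h3 ((mem_interFams.1 h𝓔).1.1 hmem)
  | step h1 _ _ h4 => exact not_disjoint_of_mem_interFams h𝓔 hmem h1.mem h4

open Classical in
/-- Compress exactly the members of `𝓔` that must move. -/
noncomputable def transport (U : Finset ℕ) (v : ℕ) (f : ℕ → ℕ) (𝓐 𝓔 : Finset (Finset ℕ)) :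
    Finset (Finset ℕ) :=
  𝓔.image fun X => if Moves U v f 𝓐 𝓔 X then cSet U v f X else X

theorem mem_transport {𝓔 : Finset (Finset ℕ)} {Z : Finset ℕ} :
    Z ∈ transport U v f 𝓐 𝓔 ↔
      (∃ X, Moves U v f 𝓐 𝓔 X ∧ cSet U v f X = Z) ∨ (Z ∈ 𝓔 ∧ ¬ Moves U v f 𝓐 𝓔 Z) := by
  classical
  rw [transport, mem_image]
  constructor
  · rintro ⟨X, hX, rfl⟩
    split_ifs with h
    · exact Or.inl ⟨X, h, rfl⟩
    · exact Or.inr ⟨hX, h⟩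
  · rintro (⟨X, hX, rfl⟩ | ⟨hZ, h⟩)
    · exact ⟨X, hX.mem, if_pos hX⟩
    · exact ⟨Z, hZ, if_neg h⟩

theorem transport_mem_interFams (hv : v ∉ U) (hfU : ∀ x ∈ U, f x ∈ U)
    (hff : ∀ x ∈ U, f (f x) = x) {s : ℕ} {𝓔 : Finset (Finset ℕ)}
    (h𝓔 : 𝓔 ∈ interFams s 𝓐) :
    transport U v f 𝓐 𝓔 ∈ interFams s (cFam U v f 𝓐) := by
  classical
  obtain ⟨⟨hsub, hcard⟩, hint⟩ := mem_interFams.1 h𝓔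
  have hmixed : ∀ X Y, Moves U v f 𝓐 𝓔 X → Y ∈ 𝓔 → ¬ Moves U v f 𝓐 𝓔 Y →
      ¬ Disjoint (cSet U v f X) Y := by
    intro X Y hX hY hnY hd
    by_cases hvY : v ∈ Y
    · exact Finset.disjoint_left.1 hd (point_mem_cSet X) hvY
    · exact hnY (.step hX hY hvY (disjoint_cSet_right hfU hff hX.notMem hd).symm)
  refine mem_interFams.2 ⟨⟨fun Z hZ => ?_, ?_⟩, fun B hB B' hB' => ?_⟩
  · rcases mem_transport.1 hZ with ⟨X, hX, rfl⟩ | ⟨hZ, hnZ⟩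
    · exact cSet_mem_cFam (hsub hX.mem) hX.notMem
    · refine mem_cFam_of_mem (hsub hZ) fun hvZ => ?_
      by_contra hc
      exact hnZ (.base hZ hvZ hc)
  · rw [← hcard]
    refine card_image_of_injOn fun X hX Y hY hXY => ?_
    beta_reduce at hXY
    split_ifs at hXY with h1 h2 h2
    · exact cSet_injOn hv hfU hff h1.notMem h2.notMem hXY
    · exact absurd (hXY ▸ hY) (h1.cSet_notMem h𝓔)
    · exact absurd (hXY ▸ hX) (h2.cSet_notMem h𝓔)
    · exact hXY
  · rw [← not_disjoint_iff_nonempty_inter]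
    rcases mem_transport.1 hB with ⟨X, hX, rfl⟩ | ⟨h1, h2⟩ <;>
      rcases mem_transport.1 hB' with ⟨Y, hY, rfl⟩ | ⟨h3, h4⟩
    · exact not_disjoint_iff.2 ⟨v, point_mem_cSet X, point_mem_cSet Y⟩
    · exact hmixed X B' hX h3 h4
    · exact fun hd => hmixed Y B hY h1 h2 hd.symm
    · exact not_disjoint_of_mem_interFams h𝓔 h1 h3

theorem Moves.of_transport_eq (hv : v ∉ U) (hfU : ∀ x ∈ U, f x ∈ U)
    (hff : ∀ x ∈ U, f (f x) = x) {s : ℕ} {𝓔 𝓔' : Finset (Finset ℕ)}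
    (h𝓔' : 𝓔' ∈ interFams s 𝓐)
    (h : transport U v f 𝓐 𝓔 = transport U v f 𝓐 𝓔') {X : Finset ℕ}
    (hX : Moves U v f 𝓐 𝓔 X) : Moves U v f 𝓐 𝓔' X := by
  have key : ∀ X, Moves U v f 𝓐 𝓔 X → cSet U v f X ∉ 𝓔' → Moves U v f 𝓐 𝓔' X := by
    intro X hX hn
    have hmem : cSet U v f X ∈ transport U v f 𝓐 𝓔' :=
      h ▸ mem_transport.2 (Or.inl ⟨X, hX, rfl⟩)
    rcases mem_transport.1 hmem with ⟨Z, hZ, hZX⟩ | ⟨h1, _⟩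
    · exact cSet_injOn hv hfU hff hZ.notMem hX.notMem hZX ▸ hZ
    · exact absurd h1 hn
  induction hX with
  | base h1 h2 h3 =>
    exact key _ (.base h1 h2 h3) fun hc => h3 ((mem_interFams.1 h𝓔').1.1 hc)
  | step h1 h2 h3 h4 ih =>
    exact key _ (.step h1 h2 h3 h4) fun hc => not_disjoint_of_mem_interFams h𝓔' hc ih.mem h4

theorem subset_of_transport_eq (hv : v ∉ U) (hfU : ∀ x ∈ U, f x ∈ U)
    (hff : ∀ x ∈ U, f (f x) = x) {s : ℕ} {𝓔 𝓔' : Finset (Finset ℕ)}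
    (h𝓔 : 𝓔 ∈ interFams s 𝓐) (h𝓔' : 𝓔' ∈ interFams s 𝓐)
    (h : transport U v f 𝓐 𝓔 = transport U v f 𝓐 𝓔') : 𝓔 ⊆ 𝓔' := by
  intro X hX
  by_cases hm : Moves U v f 𝓐 𝓔 X
  · exact (hm.of_transport_eq hv hfU hff h𝓔' h).mem
  · have hmem : X ∈ transport U v f 𝓐 𝓔' := h ▸ mem_transport.2 (Or.inr ⟨hX, hm⟩)
    rcases mem_transport.1 hmem with ⟨Y, hY, rfl⟩ | ⟨h1, _⟩
    · exact absurd hX ((hY.of_transport_eq hv hfU hff h𝓔 h.symm).cSet_notMem h𝓔)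
    · exact h1

theorem transport_injOn (hv : v ∉ U) (hfU : ∀ x ∈ U, f x ∈ U)
    (hff : ∀ x ∈ U, f (f x) = x) (s : ℕ) :
    Set.InjOn (transport U v f 𝓐) (interFams s 𝓐) := fun _ h𝓔 _ h𝓔' h =>
  (subset_of_transport_eq hv hfU hff h𝓔 h𝓔' h).antisymm
    (subset_of_transport_eq hv hfU hff h𝓔' h𝓔 h.symm)

/-- A compression strictly increases the number of intersecting subfamilies as soon as some
new intersecting subfamily contains both `C(A) ∉ 𝓐` and a set `A' ∌ v` disjoint from `A`. -/
theorem card_interFams_lt_of_mem (hv : v ∉ U) (hfU : ∀ x ∈ U, f x ∈ U)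
    (hff : ∀ x ∈ U, f (f x) = x) {s : ℕ} {𝓕 : Finset (Finset ℕ)}
    (h𝓕 : 𝓕 ∈ interFams s (cFam U v f 𝓐)) {A A' : Finset ℕ} (hvA : v ∉ A) (hvA' : v ∉ A')
    (hdisj : Disjoint A A') (hCA : cSet U v f A ∉ 𝓐) (hA𝓕 : cSet U v f A ∈ 𝓕)
    (hA'𝓕 : A' ∈ 𝓕) :
    (interFams s 𝓐).card < (interFams s (cFam U v f 𝓐)).card := by
  classical
  rw [← card_image_of_injOn (transport_injOn hv hfU hff s)]
  refine card_lt_card ⟨?_, fun hsup => ?_⟩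
  · exact image_subset_iff.2 fun 𝓔 h𝓔 => transport_mem_interFams hv hfU hff h𝓔
  · obtain ⟨𝓔, h𝓔, rfl⟩ := mem_image.1 (hsup h𝓕)
    have hA : A ∈ 𝓔 := by
      rcases mem_transport.1 hA𝓕 with ⟨X, hX, hXA⟩ | ⟨h1, _⟩
      · exact cSet_injOn hv hfU hff hX.notMem hvA hXA ▸ hX.mem
      · exact absurd ((mem_interFams.1 h𝓔).1.1 h1) hCA
    have hA' : A' ∈ 𝓔 := by
      rcases mem_transport.1 hA'𝓕 with ⟨X, hX, rfl⟩ | ⟨h1, _⟩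
      · exact absurd (point_mem_cSet X) hvA'
      · exact h1
    exact not_disjoint_of_mem_interFams h𝓔 hA hA' hdisj

end Compression

theorem exists_involution_swapping {S T : Finset ℕ} (hST : Disjoint S T)
    (hcard : S.card = T.card) :
    ∃ f : ℕ → ℕ, (∀ x ∈ S, f x ∈ T) ∧ (∀ x ∈ T, f x ∈ S) ∧ ∀ x ∈ S ∪ T, f (f x) = x := by
  classical
  let e : S ≃ T := Finset.equivOfCardEq hcard
  let f : ℕ → ℕ := fun x =>
    if h : x ∈ S then e ⟨x, h⟩ else if h : x ∈ T then e.symm ⟨x, h⟩ else x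
  have hTS : ∀ x ∈ T, x ∉ S := fun x hx hx' => Finset.disjoint_left.1 hST hx' hx
  have hfS : ∀ x (h : x ∈ S), f x = e ⟨x, h⟩ := fun x h => dif_pos h
  have hfT : ∀ x (h : x ∈ T), f x = e.symm ⟨x, h⟩ := fun x h => by
    simp only [f, dif_neg (hTS x h), dif_pos h]
  refine ⟨f, fun x hx => ?_, fun x hx => ?_, fun x hx => ?_⟩
  · rw [hfS x hx]; exact (e ⟨x, hx⟩).2
  · rw [hfT x hx]; exact (e.symm ⟨x, hx⟩).2
  · rcases mem_union.1 hx with h | h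
    · rw [hfS x h, hfT _ (e ⟨x, h⟩).2]; simp
    · rw [hfT x h, hfS _ (e.symm ⟨x, h⟩).2]; simp

/-- For `|A| = |E|` and `v ∉ A ∪ E` there is a compression at `v` taking `A` to `E ∪ {v}`. -/
theorem exists_isUVF_cSet_eq {n v : ℕ} {A E : Finset ℕ} (hA : A ⊆ Finset.Icc 1 n)
    (hE : E ⊆ Finset.Icc 1 n) (hcard : A.card = E.card) (hv : v ∈ Finset.Icc 1 n)
    (hvA : v ∉ A) (hvE : v ∉ E) :
    ∃ (U : Finset ℕ) (f : ℕ → ℕ), IsUVF n U v f ∧ cSet U v f A = insert v E := by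
  have hdisj : Disjoint (A \ E) (E \ A) := disjoint_sdiff_sdiff
  have hcard' : (A \ E).card = (E \ A).card := card_sdiff_comm hcard
  obtain ⟨f, hfS, hfT, hff⟩ := exists_involution_swapping hdisj hcard'
  refine ⟨A \ E ∪ E \ A, f, ⟨?_, ?_, hv, ?_, ?_, hff, ?_⟩, ?_⟩
  · exact union_subset (sdiff_subset.trans hA) (sdiff_subset.trans hE)
  · rw [card_union_of_disjoint hdisj, hcard']
    exact ⟨_, rfl⟩
  · simp [hvA, hvE]
  · intro x hx
    rcases mem_union.1 hx with h | h
    · exact mem_union_right _ (hfS x h)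
    · exact mem_union_left _ (hfT x h)
  · intro x hx hfx
    rcases mem_union.1 hx with h | h
    · exact Finset.disjoint_left.1 hdisj h (hfx ▸ hfS x h)
    · exact Finset.disjoint_left.1 hdisj (hfx ▸ hfT x h) h
  · ext x
    rw [mem_cSet, mem_insert]
    constructor
    · rintro (⟨h1, h2⟩ | rfl | ⟨y, ⟨hy, hyU⟩, rfl⟩)
      · right
        by_contra hxE
        exact h2 (mem_union_left _ (mem_sdiff.2 ⟨h1, hxE⟩))
      · exact Or.inl rfl
      · rcases mem_union.1 hyU with h | h
        · exact Or.inr (mem_sdiff.1 (hfS y h)).1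
        · exact absurd hy (mem_sdiff.1 h).2
    · rintro (rfl | hx)
      · exact Or.inr (Or.inl rfl)
      · by_cases hxA : x ∈ A
        · left
          simp [hx, hxA]
        · have hxT : x ∈ E \ A := mem_sdiff.2 ⟨hx, hxA⟩
          have hfx := hfT x hxT
          exact Or.inr (Or.inr ⟨f x, ⟨(mem_sdiff.1 hfx).1, mem_union_left _ hfx⟩,
            hff x (mem_union_right _ hxT)⟩)

theorem card_layerGE_two_mul_add_one (ℓ : ℕ) :
    (layerGE (2 * ℓ + 1) (ℓ + 1)).card = 2 ^ (2 * ℓ) := by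
  have hg : (groundSet (2 * ℓ + 1)).card = 2 * ℓ + 1 := by simp [groundSet]
  have hsum := card_filter_add_card_filter_not (s := allFams (2 * ℓ + 1))
    (fun X : Finset ℕ => ℓ + 1 ≤ X.card)
  have hall : (allFams (2 * ℓ + 1)).card = 2 ^ (2 * ℓ) * 2 := by
    rw [allFams, card_powerset, hg, pow_succ]
  have hcompl : ∀ X ∈ allFams (2 * ℓ + 1),
      (groundSet (2 * ℓ + 1) \ X).card + X.card = 2 * ℓ + 1 := fun X hX => by
    rw [card_sdiff_add_card_eq_card (mem_powerset.1 hX), hg]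
  have heq : ((allFams (2 * ℓ + 1)).filter fun X => ℓ + 1 ≤ X.card).card =
      ((allFams (2 * ℓ + 1)).filter fun X => ¬ ℓ + 1 ≤ X.card).card := by
    refine card_nbij' (fun X => groundSet (2 * ℓ + 1) \ X)
      (fun X => groundSet (2 * ℓ + 1) \ X) ?_ ?_ ?_ ?_
    · intro X hX
      obtain ⟨h1, h2⟩ := mem_filter.1 hX
      have := hcompl X h1
      exact mem_filter.2 ⟨mem_powerset.2 sdiff_subset, by beta_reduce; omega⟩
    · intro X hX
      obtain ⟨h1, h2⟩ := mem_filter.1 hX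
      have := hcompl X h1
      exact mem_filter.2 ⟨mem_powerset.2 sdiff_subset, by beta_reduce; omega⟩
    · intro X hX
      exact Finset.sdiff_sdiff_eq_self (mem_powerset.1 (mem_filter.1 hX).1)
    · intro X hX
      exact Finset.sdiff_sdiff_eq_self (mem_powerset.1 (mem_filter.1 hX).1)
  rw [layerGE]
  omega

theorem not_disjoint_of_card_lt {G X Y : Finset ℕ} (hX : X ⊆ G) (hY : Y ⊆ G)
    (h : G.card < X.card + Y.card) : ¬ Disjoint X Y := fun hd =>
  absurd (card_le_card (union_subset hX hY)) (by rw [card_union_of_disjoint hd]; omega)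

theorem exists_compression_of_not_disjoint {s ℓ : ℕ} (hs1 : 2 ≤ s) (hs2 : s ≤ 2 ^ (2 * ℓ))
    {𝓐 : Finset (Finset ℕ)} (h𝓐 : 𝓐 ⊆ allFams (2 * ℓ + 1))
    (hsub : (layerGE (2 * ℓ + 1) (ℓ + 1)).erase (Finset.Icc (ℓ + 1) (2 * ℓ + 1)) ⊆ 𝓐)
    (hnotin : Finset.Icc (ℓ + 1) (2 * ℓ + 1) ∉ 𝓐) {A A' : Finset ℕ} (hA : A ∈ 𝓐)
    (hA' : A' ∈ 𝓐) (hAcard : A.card = ℓ) (hA'card : A'.card = ℓ) (hnA : 2 * ℓ + 1 ∉ A)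
    (hnA' : 2 * ℓ + 1 ∉ A') (hdisj : Disjoint A A')
    (hmeet : ¬ Disjoint (Finset.Icc (ℓ + 1) (2 * ℓ + 1)) A') :
    ∃ (U : Finset ℕ) (v : ℕ) (f : ℕ → ℕ), IsUVF (2 * ℓ + 1) U v f ∧
      (interFams s 𝓐).card < (interFams s (cFam U v f 𝓐)).card := by
  set n := 2 * ℓ + 1 with hn
  have hAn : A ⊆ Finset.Icc 1 n := mem_powerset.1 (h𝓐 hA)
  have hA'n : A' ⊆ Finset.Icc 1 n := mem_powerset.1 (h𝓐 hA')
  have hnmem : n ∈ Finset.Icc 1 n := by simp [hn]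
  have hB : insert n (Finset.Icc (ℓ + 1) (2 * ℓ)) = Finset.Icc (ℓ + 1) n := by
    ext x; simp only [mem_insert, Finset.mem_Icc]; omega
  obtain ⟨U, f, hUVF, hCA⟩ := exists_isUVF_cSet_eq (E := Finset.Icc (ℓ + 1) (2 * ℓ)) hAn
    (fun x hx => by simp only [Finset.mem_Icc] at hx ⊢; omega)
    (by rw [hAcard, Nat.card_Icc]; omega) hnmem hnA (by simp [hn])
  rw [hB] at hCA
  obtain ⟨hU, -, -, hvU, hfU, hff, -⟩ := id hUVF
  refine ⟨U, n, f, hUVF, ?_⟩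
  set 𝓛 := layerGE n (ℓ + 1) with h𝓛
  have hmem𝓛 : ∀ X, X ∈ 𝓛 ↔ X ⊆ Finset.Icc 1 n ∧ ℓ + 1 ≤ X.card := fun X => by
    rw [h𝓛, layerGE, mem_filter, allFams, mem_powerset, groundSet]
  have hcardn : (Finset.Icc 1 n).card = 2 * ℓ + 1 := by simp [hn]
  have hBn : Finset.Icc (ℓ + 1) n ⊆ Finset.Icc 1 n := Finset.Icc_subset_Icc (by omega) le_rfl
  have hBcard : (Finset.Icc (ℓ + 1) n).card = ℓ + 1 := by rw [Nat.card_Icc]; omega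
  have hcomplA' : Disjoint (insert n A) A' := disjoint_insert_left.2 ⟨hnA', hdisj⟩
  have hcompl𝓛 : insert n A ∈ 𝓛 :=
    (hmem𝓛 _).2 ⟨insert_subset hnmem hAn, by rw [card_insert_of_notMem hnA, hAcard]⟩
  have hA'𝓛 : A' ∉ 𝓛 := fun h => by have := ((hmem𝓛 _).1 h).2; omega
  have hnonempty : ∀ X ∈ 𝓛.erase (insert n A), ¬ Disjoint X A' := by
    intro X hX hd
    obtain ⟨hne, hX𝓛⟩ := mem_erase.1 hX
    obtain ⟨hXn, hXc⟩ := (hmem𝓛 X).1 hX𝓛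
    refine hne (eq_of_subset_of_card_le ?_ ?_)
    · have hun : insert n A ∪ A' = Finset.Icc 1 n := by
        refine eq_of_subset_of_card_le (union_subset (insert_subset hnmem hAn) hA'n) ?_
        rw [card_union_of_disjoint hcomplA', card_insert_of_notMem hnA]
        omega
      intro x hx
      rcases mem_union.1 (hun ▸ hXn hx) with h | h
      · exact h
      · exact absurd h (Finset.disjoint_left.1 hd hx)
    · rw [card_insert_of_notMem hnA]; omega
  have hA'self : ¬ Disjoint A' A' := by
    obtain ⟨x, -, hx⟩ := not_disjoint_iff.1 hmeet
    exact not_disjoint_iff.2 ⟨x, hx, hx⟩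
  have hBmem : Finset.Icc (ℓ + 1) n ∈ 𝓛.erase (insert n A) :=
    mem_erase.2 ⟨fun h => hmeet (h ▸ hcomplA'), (hmem𝓛 _).2 ⟨hBn, hBcard.ge⟩⟩
  obtain ⟨𝓕, h1, h2, h3⟩ := exists_subsuperset_card_eq
    (s := {Finset.Icc (ℓ + 1) n, A'}) (t := insert A' (𝓛.erase (insert n A))) (n := s)
    (by
      rw [insert_subset_iff, singleton_subset_iff]
      exact ⟨mem_insert_of_mem hBmem, mem_insert_self _ _⟩)
    (card_le_two.trans hs1)
    (by
      rw [card_insert_of_notMem fun h => hA'𝓛 (mem_of_mem_erase h), card_erase_of_mem hcompl𝓛,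
        card_layerGE_two_mul_add_one]
      omega)
  have hB𝓕 : cSet U n f A ∈ 𝓕 := hCA ▸ h1 (mem_insert_self _ _)
  have hA'𝓕 : A' ∈ 𝓕 := h1 (mem_insert_of_mem (mem_singleton_self _))
  refine card_interFams_lt_of_mem hvU hfU hff (𝓕 := 𝓕) ?_ hnA hnA' hdisj (hCA ▸ hnotin)
    hB𝓕 hA'𝓕
  have hcompressed : ∀ X ∈ 𝓐, ℓ ≤ X.card → n ∉ X → X ≠ A → cSet U n f X ∈ 𝓐 := by
    intro X hX hXc hnX hXA
    refine hsub (mem_erase.2 ⟨fun h => hXA ?_, mem_filter.2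
      ⟨cSet_mem_allFams hU hnmem hfU (h𝓐 hX), ?_⟩⟩)
    · exact cSet_injOn hvU hfU hff hnX hnA (h.trans hCA.symm)
    · rw [card_cSet hvU hfU hff hnX]; omega
  refine mem_interFams.2 ⟨⟨fun X hX => ?_, h3⟩, fun X hX Y hY => ?_⟩
  · rcases mem_insert.1 (h2 hX) with rfl | h
    · exact mem_cFam_of_mem hA' fun h => hcompressed X hA' hA'card.ge h
        fun h' => hA'self (by rw [← h'] at hdisj; exact hdisj)
    · by_cases hXB : X = Finset.Icc (ℓ + 1) n
      · rw [hXB, ← hCA]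
        exact cSet_mem_cFam hA hnA
      · have hX𝓛 := mem_of_mem_erase h
        have hXc := ((hmem𝓛 X).1 hX𝓛).2
        have hX𝓐 : X ∈ 𝓐 := hsub (mem_erase.2 ⟨hXB, hX𝓛⟩)
        exact mem_cFam_of_mem hX𝓐 fun h => hcompressed X hX𝓐 (by omega) h
          fun h' => by rw [h'] at hXc; omega
  · rw [← not_disjoint_iff_nonempty_inter]
    rcases mem_insert.1 (h2 hX) with hX' | hX' <;> rcases mem_insert.1 (h2 hY) with hY' | hY'
    · rwa [hX', hY']
    · exact fun hd => hnonempty Y hY' (hX' ▸ hd.symm)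
    · exact fun hd => hnonempty X hX' (hY' ▸ hd)
    · obtain ⟨hXn, hXc⟩ := (hmem𝓛 X).1 (mem_of_mem_erase hX')
      obtain ⟨hYn, hYc⟩ := (hmem𝓛 Y).1 (mem_of_mem_erase hY')
      exact not_disjoint_of_card_lt hXn hYn (by omega)

theorem stmt14 (n s ℓ : ℕ) (hn : 5 ≤ n) (hodd : Odd n)
    (hs1 : 2 ≤ s) (hs2 : s ≤ 2 ^ (n - 1)) (hℓ : ℓ = (n - 1) / 2)
    (𝓐 : Finset (Finset ℕ)) (h𝓐 : 𝓐 ⊆ allFams n)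
    (hsub : (layerGE n (ℓ + 1)).erase (Finset.Icc (n - ℓ) n) ⊆ 𝓐)
    (hnotin : Finset.Icc (n - ℓ) n ∉ 𝓐)
    (A A' : Finset ℕ) (hA : A ∈ 𝓐) (hA' : A' ∈ 𝓐)
    (hAcard : A.card = ℓ) (hA'card : A'.card = ℓ)
    (hnA : n ∉ A) (hnA' : n ∉ A') (hdisj : A ∩ A' = ∅) :
    ∃ (U : Finset ℕ) (v : ℕ) (f : ℕ → ℕ), IsUVF n U v f ∧
      (interFams s 𝓐).card < (interFams s (cFam U v f 𝓐)).card := by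
  obtain ⟨m, rfl⟩ := hodd
  obtain rfl : ℓ = m := by omega
  rw [show 2 * ℓ + 1 - ℓ = ℓ + 1 by omega] at hsub hnotin
  rw [Nat.add_sub_cancel] at hs2
  have hd : Disjoint A A' := disjoint_iff_inter_eq_empty.2 hdisj
  by_cases hmeet : Disjoint (Finset.Icc (ℓ + 1) (2 * ℓ + 1)) A'
  · refine exists_compression_of_not_disjoint hs1 hs2 h𝓐 hsub hnotin hA' hA hA'card hAcard
      hnA' hnA hd.symm fun hmeet' => ?_
    have hAn : A ⊆ Finset.Icc 1 (2 * ℓ + 1) := mem_powerset.1 (h𝓐 hA)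
    have hA'n : A' ⊆ Finset.Icc 1 (2 * ℓ + 1) := mem_powerset.1 (h𝓐 hA')
    refine not_disjoint_of_card_lt (G := Finset.Icc 1 (2 * ℓ + 1)) (union_subset hAn hA'n)
      (Finset.Icc_subset_Icc (by omega) le_rfl) ?_
      (disjoint_union_left.2 ⟨hmeet'.symm, hmeet.symm⟩)
    rw [card_union_of_disjoint hd, Nat.card_Icc, Nat.card_Icc]
    omega
  · exact exists_compression_of_not_disjoint hs1 hs2 h𝓐 hsub hnotin hA hA' hAcard hA'card
      hnA hnA' hd hmeet
end

section
/- Let t ≥ 1 and n ≥ 2t. Suppose 𝓑 is an intersecting family of subsets of [n], each of size at most t, and that 𝓑 contains at least one set of size strictly less than t. Then the number of minimal elements of 𝓑 — sets B ∈ 𝓑 such that no B' ∈ 𝓑 satisfies B' ⊊ B — is at most C(n−1, t−1) − (n − t). -/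
open Finset

theorem card_filter_card_le_succ {α : Type*} (𝒜 : Finset (Finset α)) (j : ℕ) :
    #{A ∈ 𝒜 | #A ≤ j + 1} = #{A ∈ 𝒜 | #A ≤ j} + #{A ∈ 𝒜 | #A = j + 1} := by
  classical
  rw [← card_union_of_disjoint, ← filter_or]
  · simp only [Nat.le_succ_iff]
  · exact disjoint_filter.2 fun A _ h => by omega

section UpShadow

open scoped FinsetFamily

variable {α : Type*} [Fintype α] [DecidableEq α]

theorem card_upShadow_singleton (B : Finset α) :
    #(∂⁺ {B}) = Fintype.card α - #B := by
  have h : ∂⁺ {B} = Bᶜ.image fun a => insert a B := by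
    ext C
    simp [mem_upShadow_iff]
  rw [h, card_image_of_injOn, card_compl]
  intro a ha b hb hab
  exact (insert_inj (by simpa using ha)).1 hab

theorem card_add_le_card_upShadow {𝒢 : Finset (Finset α)} {k : ℕ}
    (h𝒢 : (𝒢 : Set (Finset α)).Sized k) (hne : 𝒢.Nonempty)
    (hk : 2 * (k + 1) ≤ Fintype.card α) :
    #𝒢 + (Fintype.card α - (k + 1)) ≤ #(∂⁺ 𝒢) := by
  obtain ⟨A, hA⟩ := hne
  have hmul : #(𝒢.erase A) * (k + 1) ≤ #(∂⁺ 𝒢 \ ∂⁺ {A}) * (k + 1) := by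
    refine card_mul_le_card_mul (fun B C => B ⊆ C) (fun B hB => ?_) (fun C hC => ?_)
    · obtain ⟨hBA, hB⟩ := mem_erase.1 hB
      have hsub : ∂⁺ {B} \ {A ∪ B} ⊆ (∂⁺ 𝒢 \ ∂⁺ {A}).bipartiteAbove (fun B C => B ⊆ C) B := by
        intro C hC
        rw [mem_sdiff, mem_singleton] at hC
        obtain ⟨hCB, hCne⟩ := hC
        have hBC : B ⊆ C ∧ #C = #B + 1 := by
          simpa [mem_upShadow_iff_exists_mem_card_add_one] using hCB
        rw [mem_bipartiteAbove, mem_sdiff]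
        refine ⟨⟨upShadow_monotone (singleton_subset_iff.2 hB) hCB, fun hCA => hCne ?_⟩, hBC.1⟩
        have hAC : A ⊆ C ∧ #C = #A + 1 := by
          simpa [mem_upShadow_iff_exists_mem_card_add_one] using hCA
        symm
        apply eq_of_subset_of_card_le (union_subset hAC.1 hBC.1)
        have hss : A ⊂ A ∪ B := by
          refine subset_union_left.ssubset_of_ne fun h => hBA ?_
          exact eq_of_subset_of_card_le (union_eq_left.1 h.symm) (by rw [h𝒢 hA, h𝒢 hB])
        have := card_lt_card hss
        omega
      have h1 := card_le_card hsub
      have h2 := le_card_sdiff {A ∪ B} (∂⁺ {B})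
      rw [card_upShadow_singleton, h𝒢 hB, card_singleton] at h2
      omega
    · have hC' : #C = k + 1 := h𝒢.upShadow (mem_sdiff.1 hC).1
      calc _ ≤ #(powersetCard k C) := by
            apply card_le_card
            intro B hB
            rw [mem_bipartiteBelow] at hB
            exact mem_powersetCard.2 ⟨hB.2, h𝒢 (mem_of_mem_erase hB.1)⟩
        _ = k + 1 := by simp [hC']
  have hle := Nat.le_of_mul_le_mul_right hmul k.succ_pos
  have hsub : ∂⁺ {A} ⊆ ∂⁺ 𝒢 := upShadow_monotone (singleton_subset_iff.2 hA)
  rw [card_erase_of_mem hA, card_sdiff_of_subset hsub, card_upShadow_singleton, h𝒢 hA] at hle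
  have h1 := card_le_card hsub
  rw [card_upShadow_singleton, h𝒢 hA] at h1
  omega

/-- The sets of size `j` containing a member of `𝒜`. -/
def supersetLayer (𝒜 : Finset (Finset α)) (j : ℕ) : Finset (Finset α) :=
  {S | #S = j ∧ ∃ A ∈ 𝒜, A ⊆ S}

theorem mem_supersetLayer {𝒜 : Finset (Finset α)} {j : ℕ} {S : Finset α} :
    S ∈ supersetLayer 𝒜 j ↔ #S = j ∧ ∃ A ∈ 𝒜, A ⊆ S := by
  simp [supersetLayer]

theorem sized_supersetLayer (𝒜 : Finset (Finset α)) (j : ℕ) :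
    (supersetLayer 𝒜 j : Set (Finset α)).Sized j :=
  fun _ hS => (mem_supersetLayer.1 hS).1

theorem card_upShadow_supersetLayer_add_le {𝒜 : Finset (Finset α)}
    (h𝒜 : IsAntichain (· ⊆ ·) (𝒜 : Set (Finset α))) (j : ℕ) :
    #(∂⁺ (supersetLayer 𝒜 j)) + #{A ∈ 𝒜 | #A = j + 1} ≤ #(supersetLayer 𝒜 (j + 1)) := by
  rw [← card_union_of_disjoint]
  · apply card_le_card
    refine union_subset (fun S hS => ?_) fun S hS => ?_
    · obtain ⟨T, hT, hTS, hcard⟩ := mem_upShadow_iff_exists_mem_card_add_one.1 hS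
      obtain ⟨rfl, A, hA, hAT⟩ := mem_supersetLayer.1 hT
      exact mem_supersetLayer.2 ⟨hcard, A, hA, hAT.trans hTS⟩
    · rw [mem_filter] at hS
      exact mem_supersetLayer.2 ⟨hS.2, S, hS.1, Subset.rfl⟩
  · rw [disjoint_left]
    intro S hS hS'
    obtain ⟨T, hT, hTS, hcard⟩ := mem_upShadow_iff_exists_mem_card_add_one.1 hS
    obtain ⟨rfl, A, hA, hAT⟩ := mem_supersetLayer.1 hT
    have hAS : A = S := h𝒜.eq hA (mem_filter.1 hS').1 (hAT.trans hTS)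
    have := card_le_card hAT
    rw [hAS] at this
    omega

theorem card_filter_card_le_le_card_supersetLayer {𝒜 : Finset (Finset α)}
    (h𝒜 : IsAntichain (· ⊆ ·) (𝒜 : Set (Finset α))) {j : ℕ} (hj : 2 * j ≤ Fintype.card α) :
    #{A ∈ 𝒜 | #A ≤ j} ≤ #(supersetLayer 𝒜 j) := by
  induction j with
  | zero =>
    apply card_le_card
    intro A hA
    rw [mem_filter] at hA
    exact mem_supersetLayer.2 ⟨by omega, A, hA.1, Subset.rfl⟩
  | succ j ih =>
    have h1 := ih (by omega)
    have h2 := card_upShadow_supersetLayer_add_le h𝒜 j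
    have h3 : #(supersetLayer 𝒜 j) ≤ #(∂⁺ (supersetLayer 𝒜 j)) := by
      rcases (supersetLayer 𝒜 j).eq_empty_or_nonempty with h | h
      · simp [h]
      · exact le_of_add_le_left (card_add_le_card_upShadow (sized_supersetLayer 𝒜 j) h hj)
    rw [card_filter_card_le_succ]
    omega

theorem card_add_le_card_supersetLayer {𝒜 : Finset (Finset α)} {t : ℕ}
    (h𝒜 : IsAntichain (· ⊆ ·) (𝒜 : Set (Finset α))) (ht : 2 * t ≤ Fintype.card α)
    (hle : ∀ A ∈ 𝒜, #A ≤ t) (hlt : ∃ A ∈ 𝒜, #A < t) :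
    #𝒜 + (Fintype.card α - t) ≤ #(supersetLayer 𝒜 t) := by
  obtain ⟨A, hA, hAt⟩ := hlt
  obtain ⟨m, rfl⟩ : ∃ m, t = m + 1 := ⟨t - 1, by omega⟩
  have hne : (supersetLayer 𝒜 m).Nonempty := by
    obtain ⟨S, hAS, hS⟩ := exists_superset_card_eq (s := A) (n := m) (by omega) (by omega)
    exact ⟨S, mem_supersetLayer.2 ⟨hS, A, hA, hAS⟩⟩
  have h1 := card_filter_card_le_le_card_supersetLayer h𝒜 (j := m) (by omega)
  have h2 := card_upShadow_supersetLayer_add_le h𝒜 m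
  have h3 := card_add_le_card_upShadow (sized_supersetLayer 𝒜 m) hne ht
  have h4 := card_filter_card_le_succ 𝒜 m
  rw [filter_true_of_mem hle] at h4
  omega

end UpShadow

theorem IsAntichain.card_add_le_choose_of_intersecting {n t : ℕ} {𝒜 : Finset (Finset (Fin n))}
    (h𝒜 : IsAntichain (· ⊆ ·) (𝒜 : Set (Finset (Fin n))))
    (hint : (𝒜 : Set (Finset (Fin n))).Intersecting) (ht : 2 * t ≤ n)
    (hle : ∀ A ∈ 𝒜, #A ≤ t) (hlt : ∃ A ∈ 𝒜, #A < t) :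
    #𝒜 + (n - t) ≤ (n - 1).choose (t - 1) := by
  have h := card_add_le_card_supersetLayer h𝒜 (by simpa using ht) hle hlt
  rw [Fintype.card_fin] at h
  refine h.trans (erdos_ko_rado (fun S hS T hT hST => ?_) (sized_supersetLayer 𝒜 t) (by omega))
  obtain ⟨-, A, hA, hAS⟩ := mem_supersetLayer.1 hS
  obtain ⟨-, B, hB, hBT⟩ := mem_supersetLayer.1 hT
  exact hint hA hB (hST.mono hAS hBT)

theorem exists_map_eq_of_mem_allFams {n : ℕ} {B : Finset ℕ} (hB : B ∈ allFams n) :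
    ∃ A : Finset (Fin n), A.map (Fin.valEmbedding.trans (addRightEmbedding 1)) = B := by
  refine ⟨univ.filter fun i : Fin n => (i : ℕ) + 1 ∈ B, ?_⟩
  ext x
  simp only [mem_map, mem_filter, mem_univ, true_and, Function.Embedding.trans_apply,
    Fin.valEmbedding_apply, addRightEmbedding_apply]
  constructor
  · rintro ⟨i, hi, rfl⟩
    exact hi
  · intro hx
    have hx' := mem_Icc.1 (mem_powerset.1 hB hx)
    have hx1 : x - 1 + 1 = x := by omega
    exact ⟨⟨x - 1, by omega⟩, by simpa [hx1] using hx, hx1⟩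

theorem stmt15 (n t : ℕ) (ht : 1 ≤ t) (hn : 2 * t ≤ n)
    (𝓑 : Finset (Finset ℕ)) (h𝓑 : 𝓑 ⊆ allFams n)
    (hint : ∀ B ∈ 𝓑, ∀ B' ∈ 𝓑, (B ∩ B').Nonempty)
    (hle : ∀ B ∈ 𝓑, B.card ≤ t) (hlt : ∃ B ∈ 𝓑, B.card < t) :
    (𝓑.filter fun B => ∀ B' ∈ 𝓑, ¬B' ⊂ B).card ≤
      (n - 1).choose (t - 1) - (n - t) := by
  classical
  let f : Fin n ↪ ℕ := Fin.valEmbedding.trans (addRightEmbedding 1)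
  set ℳ := 𝓑.filter fun B => ∀ B' ∈ 𝓑, ¬B' ⊂ B with hℳ
  let 𝒜 : Finset (Finset (Fin n)) := {A | A.map f ∈ ℳ}
  have hmem : ∀ A, A ∈ 𝒜 ↔ A.map f ∈ ℳ := fun A => by simp [𝒜]
  have hex : ∀ B ∈ ℳ, ∃ A ∈ 𝒜, A.map f = B := fun B hB => by
    obtain ⟨A, rfl⟩ := exists_map_eq_of_mem_allFams (h𝓑 (mem_filter.1 hB).1)
    exact ⟨A, (hmem A).2 hB, rfl⟩
  have hcard : #ℳ ≤ #𝒜 := by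
    refine (card_le_card fun B hB => ?_).trans (card_image_le (s := 𝒜) (f := fun A => A.map f))
    exact mem_image.2 (hex B hB)
  have hanti : IsAntichain (· ⊆ ·) (𝒜 : Set (Finset (Fin n))) := by
    intro A hA B hB hne hsub
    have hA' := (hmem A).1 hA
    have hB' := (hmem B).1 hB
    exact (mem_filter.1 hB').2 _ (mem_filter.1 hA').1
      (map_ssubset_map.2 (hsub.ssubset_of_ne hne))
  have hinter : (𝒜 : Set (Finset (Fin n))).Intersecting := by
    intro A hA B hB hdisj
    have h := hint _ (mem_filter.1 ((hmem A).1 hA)).1 _ (mem_filter.1 ((hmem B).1 hB)).1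
    rw [← map_inter, map_nonempty] at h
    exact not_disjoint_iff_nonempty_inter.2 h hdisj
  have hle' : ∀ A ∈ 𝒜, #A ≤ t := fun A hA => by
    simpa using hle _ (mem_filter.1 ((hmem A).1 hA)).1
  have hlt' : ∃ A ∈ 𝒜, #A < t := by
    obtain ⟨B, hB, hBt⟩ := hlt
    obtain ⟨M, hMB, hM⟩ := 𝓑.exists_le_minimal hB
    have hMℳ : M ∈ ℳ := mem_filter.2 ⟨hM.prop, fun B' hB' hlt => hM.not_lt hB' hlt⟩
    obtain ⟨A, hA, rfl⟩ := hex M hMℳ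
    have := card_le_card hMB
    rw [card_map] at this
    exact ⟨A, hA, by omega⟩
  have := hanti.card_add_le_choose_of_intersecting hinter hn hle' hlt'
  omega
end

section
/- Let n = 2t be even with t ≥ 2, and let N be an integer with 2^(n−1) < N ≤ 2^(n−1) + C(n,t)/2 − t. Then there exists a family 𝓐 of subsets of [n] with |𝓐| = N such that for every integer s with 2 ≤ s ≤ N, 𝓐 maximises |𝕀^(s)| over all families of subsets of [n] of size N, and yet 𝓐 is not of the form [n]^(≥t+1) ∪ 𝓑 for any 𝓑 ⊆ [n]^(t). -/
open Finset

theorem mem_allFams_iff {n : ℕ} {X : Finset ℕ} : X ∈ allFams n ↔ X ⊆ groundSet n :=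
  Finset.mem_powerset

theorem mem_layerGE_iff {n r : ℕ} {X : Finset ℕ} :
    X ∈ layerGE n r ↔ X ⊆ groundSet n ∧ r ≤ X.card := by
  rw [layerGE, Finset.mem_filter, mem_allFams_iff]

theorem mem_layerEQ_iff {n r : ℕ} {X : Finset ℕ} :
    X ∈ layerEQ n r ↔ X ⊆ groundSet n ∧ X.card = r :=
  Finset.mem_powersetCard

theorem card_groundSet (n : ℕ) : (groundSet n).card = n := by
  simp [groundSet]

theorem card_groundSet_sdiff {n : ℕ} {X : Finset ℕ} (hX : X ⊆ groundSet n) :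
    (groundSet n \ X).card = n - X.card := by
  rw [Finset.card_sdiff_of_subset hX, card_groundSet]

/-- An injection from `𝓐'` to `𝓐` that preserves intersecting pairs bounds the number of
intersecting subfamilies. -/
theorem card_interFams_le_of_injOn {𝓐 𝓐' : Finset (Finset ℕ)} (G : Finset ℕ → Finset ℕ)
    (hmaps : ∀ X ∈ 𝓐', G X ∈ 𝓐) (hinj : Set.InjOn G 𝓐')
    (hdisj : ∀ X ∈ 𝓐', ∀ Y ∈ 𝓐', Disjoint (G X) (G Y) → Disjoint X Y) (s : ℕ) :
    (interFams s 𝓐').card ≤ (interFams s 𝓐).card := by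
  refine Finset.card_le_card_of_injOn (fun 𝓔 => 𝓔.image G) ?_ ?_
  · intro 𝓔 h𝓔
    simp only [interFams, Finset.coe_filter, Finset.mem_powersetCard, Set.mem_ofPred_eq] at h𝓔 ⊢
    obtain ⟨⟨hsub, hcard⟩, hint⟩ := h𝓔
    refine ⟨⟨Finset.image_subset_iff.2 fun X hX => hmaps X (hsub hX), ?_⟩, ?_⟩
    · rw [Finset.card_image_of_injOn (hinj.mono (by exact_mod_cast hsub)), hcard]
    · intro B hB B' hB'
      obtain ⟨X, hX, rfl⟩ := Finset.mem_image.1 hB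
      obtain ⟨Y, hY, rfl⟩ := Finset.mem_image.1 hB'
      rw [← Finset.not_disjoint_iff_nonempty_inter]
      intro h
      exact Finset.not_disjoint_iff_nonempty_inter.2 (hint X hX Y hY)
        (hdisj X (hsub hX) Y (hsub hY) h)
  · intro 𝓔 h𝓔 𝓕 h𝓕 h
    simp only [interFams, Finset.coe_filter, Finset.mem_powersetCard, Set.mem_ofPred_eq] at h𝓔 h𝓕
    have h' : (G '' (𝓔 : Set (Finset ℕ))) = G '' (𝓕 : Set (Finset ℕ)) := by
      have := congrArg (fun 𝓖 : Finset (Finset ℕ) => (𝓖 : Set (Finset ℕ))) h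
      simpa using this
    exact_mod_cast (hinj.image_eq_image_iff (by exact_mod_cast h𝓔.1.1)
      (by exact_mod_cast h𝓕.1.1)).1 h'

/-- The members of `𝓐` that contain `a` and whose complement also lies in `𝓐`: one representative
of each complementary pair in `𝓐`. -/
def complPairs (n a : ℕ) (𝓐 : Finset (Finset ℕ)) : Finset (Finset ℕ) :=
  𝓐.filter fun X => a ∈ X ∧ groundSet n \ X ∈ 𝓐

/-- The subsets of `[n]` containing `a` such that at least one of the set and its complement
lies in `𝓐`. -/
def coveredStar (n a : ℕ) (𝓐 : Finset (Finset ℕ)) : Finset (Finset ℕ) :=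
  (allFams n).filter fun X => a ∈ X ∧ (X ∈ 𝓐 ∨ groundSet n \ X ∈ 𝓐)

theorem card_coveredStar_add_card_complPairs {n a : ℕ} (ha : a ∈ groundSet n)
    {𝓐 : Finset (Finset ℕ)} (h𝓐 : 𝓐 ⊆ allFams n) :
    (coveredStar n a 𝓐).card + (complPairs n a 𝓐).card = 𝓐.card := by
  set U := 𝓐.filter fun X => a ∈ X with hU
  set V := (𝓐.filter fun X => a ∉ X).image (groundSet n \ ·) with hV
  have hsub : ∀ X ∈ 𝓐, X ⊆ groundSet n := fun X hX => mem_allFams_iff.1 (h𝓐 hX)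
  have hVmem : ∀ X, X ∈ V ↔ X ⊆ groundSet n ∧ a ∈ X ∧ groundSet n \ X ∈ 𝓐 := by
    intro X
    simp only [hV, Finset.mem_image, Finset.mem_filter]
    constructor
    · rintro ⟨Y, ⟨hY, haY⟩, rfl⟩
      refine ⟨Finset.sdiff_subset, Finset.mem_sdiff.2 ⟨ha, haY⟩, ?_⟩
      rwa [Finset.sdiff_sdiff_eq_self (hsub Y hY)]
    · rintro ⟨hX, haX, hc⟩
      exact ⟨_, ⟨hc, by simp [haX]⟩, Finset.sdiff_sdiff_eq_self hX⟩
  have hVcard : V.card = (𝓐.filter fun X => a ∉ X).card := by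
    refine Finset.card_image_of_injOn ?_
    intro X hX Y hY h
    simp only [Finset.coe_filter, Set.mem_ofPred_eq] at hX hY
    rw [← Finset.sdiff_sdiff_eq_self (hsub X hX.1), ← Finset.sdiff_sdiff_eq_self (hsub Y hY.1)]
    exact congrArg (groundSet n \ ·) h
  have hunion : coveredStar n a 𝓐 = U ∪ V := by
    ext X
    simp only [coveredStar, Finset.mem_filter, Finset.mem_union, hVmem, hU, mem_allFams_iff]
    have := hsub X
    tauto
  have hinter : complPairs n a 𝓐 = U ∩ V := by
    ext X
    simp only [complPairs, Finset.mem_filter, Finset.mem_inter, hVmem, hU]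
    have := hsub X
    tauto
  rw [hunion, hinter, Finset.card_union_add_card_inter, hVcard,
    Finset.card_filter_add_card_filter_not]

/-- A family that meets every complementary pair has the fewest complementary pairs among the
families of its size. -/
theorem card_complPairs_le {n a : ℕ} (ha : a ∈ groundSet n) {𝓐 𝓐' : Finset (Finset ℕ)}
    (h𝓐 : 𝓐 ⊆ allFams n) (h𝓐' : 𝓐' ⊆ allFams n) (hcard : 𝓐'.card = 𝓐.card)
    (hcover : ∀ X ⊆ groundSet n, X ∈ 𝓐 ∨ groundSet n \ X ∈ 𝓐) :
    (complPairs n a 𝓐).card ≤ (complPairs n a 𝓐').card := by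
  have h := card_coveredStar_add_card_complPairs ha h𝓐
  have h' := card_coveredStar_add_card_complPairs ha h𝓐'
  have hle : (coveredStar n a 𝓐').card ≤ (coveredStar n a 𝓐).card := by
    refine Finset.card_le_card fun X hX => ?_
    simp only [coveredStar, Finset.mem_filter, mem_allFams_iff] at hX ⊢
    exact ⟨hX.1, hX.2.1, hcover X hX.1⟩
  omega

/-- A family meeting every complementary pair, in which only complementary sets are disjoint,
maximises the number of intersecting subfamilies of each size. -/
theorem card_interFams_le {n a : ℕ} (ha : a ∈ groundSet n) {𝓐 𝓐' : Finset (Finset ℕ)}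
    (h𝓐 : 𝓐 ⊆ allFams n) (h𝓐' : 𝓐' ⊆ allFams n) (hcard : 𝓐'.card = 𝓐.card)
    (hcover : ∀ X ⊆ groundSet n, X ∈ 𝓐 ∨ groundSet n \ X ∈ 𝓐)
    (hdisj : ∀ X ∈ 𝓐, ∀ Y ∈ 𝓐, Disjoint X Y → Y = groundSet n \ X) (s : ℕ) :
    (interFams s 𝓐').card ≤ (interFams s 𝓐).card := by
  have hsub : ∀ X ∈ 𝓐, X ⊆ groundSet n := fun X hX => mem_allFams_iff.1 (h𝓐 hX)
  have hsub' : ∀ X ∈ 𝓐', X ⊆ groundSet n := fun X hX => mem_allFams_iff.1 (h𝓐' hX)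
  obtain ⟨f, hfmaps, hfinj⟩ :=
    (complPairs n a 𝓐).finite_toSet.exists_injOn_of_encard_le
      (t := (complPairs n a 𝓐' : Set (Finset ℕ)))
      (by simpa [Set.encard_coe_eq_coe_finsetCard] using
        card_complPairs_le ha h𝓐 h𝓐' hcard hcover)
  have hf : ∀ X ∈ complPairs n a 𝓐, f X ∈ 𝓐' ∧ a ∈ f X ∧ groundSet n \ f X ∈ 𝓐' := by
    intro X hX
    have : f X ∈ complPairs n a 𝓐' := by exact_mod_cast hfmaps (by exact_mod_cast hX)
    exact Finset.mem_filter.1 this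
  have hmem : ∀ X ∈ 𝓐, groundSet n \ X ∈ 𝓐 → a ∈ X → X ∈ complPairs n a 𝓐 :=
    fun X hX hc haX => Finset.mem_filter.2 ⟨hX, haX, hc⟩
  have hmem' : ∀ X ∈ 𝓐, groundSet n \ X ∈ 𝓐 → a ∉ X →
      groundSet n \ X ∈ complPairs n a 𝓐 := fun X hX hc haX =>
    hmem _ hc (by rwa [Finset.sdiff_sdiff_eq_self (hsub X hX)]) (Finset.mem_sdiff.2 ⟨ha, haX⟩)
  set φ : 𝓐 → Finset ℕ := fun X =>
    if a ∈ X.1 then f X.1 else groundSet n \ f (groundSet n \ X.1) with hφ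
  set D : Finset 𝓐 := Finset.univ.filter fun X => groundSet n \ X.1 ∈ 𝓐 with hD
  have hφmaps : D.image φ ⊆ 𝓐' := by
    refine Finset.image_subset_iff.2 ?_
    rintro ⟨X, hX⟩ hXD
    have hc : groundSet n \ X ∈ 𝓐 := (Finset.mem_filter.1 hXD).2
    by_cases haX : a ∈ X
    · simpa [hφ, haX] using (hf X (hmem X hX hc haX)).1
    · simpa [hφ, haX] using (hf _ (hmem' X hX hc haX)).2.2
  have hφinj : Set.InjOn φ D := by
    rintro ⟨X, hX⟩ hXD ⟨Y, hY⟩ hYD h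
    have hcX : groundSet n \ X ∈ 𝓐 := (Finset.mem_filter.1 hXD).2
    have hcY : groundSet n \ Y ∈ 𝓐 := (Finset.mem_filter.1 hYD).2
    refine Subtype.ext ?_
    by_cases haX : a ∈ X <;> by_cases haY : a ∈ Y <;>
      simp only [hφ, haX, haY, if_true, if_false] at h
    · exact hfinj (by exact_mod_cast hmem X hX hcX haX) (by exact_mod_cast hmem Y hY hcY haY) h
    · have h1 := (hf X (hmem X hX hcX haX)).2.1
      have h2 := (hf _ (hmem' Y hY hcY haY)).2.1
      rw [h] at h1
      exact absurd h2 (Finset.mem_sdiff.1 h1).2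
    · have h1 := (hf Y (hmem Y hY hcY haY)).2.1
      have h2 := (hf _ (hmem' X hX hcX haX)).2.1
      rw [← h] at h1
      exact absurd h2 (Finset.mem_sdiff.1 h1).2
    · have hX' := hmem' X hX hcX haX
      have hY' := hmem' Y hY hcY haY
      have h1 : f (groundSet n \ X) = f (groundSet n \ Y) := by
        rw [← Finset.sdiff_sdiff_eq_self (hsub' _ (hf _ hX').1), h,
          Finset.sdiff_sdiff_eq_self (hsub' _ (hf _ hY').1)]
      have h2 := hfinj (by exact_mod_cast hX') (by exact_mod_cast hY') h1
      change X = Y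
      rw [← Finset.sdiff_sdiff_eq_self (hsub X hX), h2, Finset.sdiff_sdiff_eq_self (hsub Y hY)]
  obtain ⟨g, hg⟩ := Finset.exists_equiv_extend_of_card_eq (by simp [hcard]) hφmaps hφinj
  refine card_interFams_le_of_injOn
    (fun X => if h : X ∈ 𝓐' then (g.symm ⟨X, h⟩).1 else X) ?_ ?_ ?_ s
  · intro X hX
    simp [hX]
  · intro X hX Y hY h
    have hX' : X ∈ 𝓐' := hX
    have hY' : Y ∈ 𝓐' := hY
    simp only [hX', hY', dif_pos] at h
    simpa using Subtype.ext h
  · intro X hX Y hY h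
    simp only [hX, hY, dif_pos] at h
    set p := g.symm ⟨X, hX⟩ with hp
    set q := g.symm ⟨Y, hY⟩ with hq
    have hpX : (g p : Finset ℕ) = X := by simp [hp]
    have hqY : (g q : Finset ℕ) = Y := by simp [hq]
    have hqp := hdisj _ p.2 _ q.2 h
    have hpq := hdisj _ q.2 _ p.2 h.symm
    have hpD : p ∈ D := Finset.mem_filter.2 ⟨Finset.mem_univ _, hqp ▸ q.2⟩
    have hqD : q ∈ D := Finset.mem_filter.2 ⟨Finset.mem_univ _, hpq ▸ p.2⟩
    rw [← hpX, ← hqY, hg p hpD, hg q hqD]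
    by_cases hap : a ∈ p.1
    · have haq : a ∉ q.1 := by
        rw [hqp]
        simp [hap]
      simp only [hφ, hap, haq, if_true, if_false, ← hpq]
      exact Finset.disjoint_sdiff
    · have haq : a ∈ q.1 := by
        rw [hqp]
        exact Finset.mem_sdiff.2 ⟨ha, hap⟩
      simp only [hφ, hap, haq, if_true, if_false, ← hqp]
      exact Finset.sdiff_disjoint

theorem card_layerEQ (n r : ℕ) : (layerEQ n r).card = n.choose r := by
  rw [layerEQ, Finset.card_powersetCard, card_groundSet]

/-- Complementation pairs up the middle layer, so half of it contains a given element. -/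
theorem two_mul_card_middle_star {t a : ℕ} (ha : a ∈ groundSet (2 * t)) :
    2 * ((layerEQ (2 * t) t).filter fun X => a ∈ X).card = (2 * t).choose t := by
  have h : ((layerEQ (2 * t) t).filter fun X => a ∈ X).card =
      ((layerEQ (2 * t) t).filter fun X => a ∉ X).card := by
    refine Finset.card_nbij' (groundSet (2 * t) \ ·) (groundSet (2 * t) \ ·) ?_ ?_ ?_ ?_
    · intro X hX
      simp only [Finset.coe_filter, mem_layerEQ_iff, Set.mem_ofPred_eq] at hX ⊢
      refine ⟨⟨Finset.sdiff_subset, ?_⟩, by simp [hX.2]⟩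
      rw [card_groundSet_sdiff hX.1.1]
      omega
    · intro X hX
      simp only [Finset.coe_filter, mem_layerEQ_iff, Set.mem_ofPred_eq] at hX ⊢
      refine ⟨⟨Finset.sdiff_subset, ?_⟩, Finset.mem_sdiff.2 ⟨ha, hX.2⟩⟩
      rw [card_groundSet_sdiff hX.1.1]
      omega
    all_goals
      intro X hX
      simp only [Finset.coe_filter, mem_layerEQ_iff, Set.mem_ofPred_eq] at hX
      exact Finset.sdiff_sdiff_eq_self hX.1.1
  have h' := Finset.card_filter_add_card_filter_not (s := layerEQ (2 * t) t) (fun X => a ∈ X)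
  rw [card_layerEQ] at h'
  omega

theorem two_mul_card_layerGE_add_choose (t : ℕ) :
    2 * (layerGE (2 * t) (t + 1)).card + (2 * t).choose t = 2 ^ (2 * t) := by
  have h : (layerGE (2 * t) (t + 1)).card =
      ((allFams (2 * t)).filter fun X => X.card < t).card := by
    refine Finset.card_nbij' (groundSet (2 * t) \ ·) (groundSet (2 * t) \ ·) ?_ ?_ ?_ ?_
    · intro X hX
      simp only [Finset.coe_filter, mem_allFams_iff, Finset.mem_coe, mem_layerGE_iff,
        Set.mem_ofPred_eq] at hX ⊢
      refine ⟨Finset.sdiff_subset, ?_⟩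
      have := Finset.card_le_card hX.1
      rw [card_groundSet] at this
      rw [card_groundSet_sdiff hX.1]
      omega
    · intro X hX
      simp only [Finset.coe_filter, mem_allFams_iff, Finset.mem_coe, mem_layerGE_iff,
        Set.mem_ofPred_eq] at hX ⊢
      refine ⟨Finset.sdiff_subset, ?_⟩
      rw [card_groundSet_sdiff hX.1]
      omega
    · intro X hX
      exact Finset.sdiff_sdiff_eq_self (mem_layerGE_iff.1 hX).1
    · intro X hX
      exact Finset.sdiff_sdiff_eq_self (mem_allFams_iff.1 (Finset.mem_filter.1 hX).1)
  have h1 := Finset.card_filter_add_card_filter_not (s := allFams (2 * t)) (fun X => X.card < t)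
  have h2 : ((allFams (2 * t)).filter fun X => ¬ X.card < t) =
      layerGE (2 * t) (t + 1) ∪ layerEQ (2 * t) t := by
    ext X
    simp only [Finset.mem_filter, mem_allFams_iff, Finset.mem_union, mem_layerGE_iff,
      mem_layerEQ_iff, ← and_or_left]
    refine and_congr_right fun _ => ?_
    omega
  have h3 : Disjoint (layerGE (2 * t) (t + 1)) (layerEQ (2 * t) t) := by
    refine Finset.disjoint_left.2 fun X hX hX' => ?_
    have := (mem_layerGE_iff.1 hX).2
    have := (mem_layerEQ_iff.1 hX').2
    omega
  rw [h2, Finset.card_union_of_disjoint h3, card_layerEQ, allFams, Finset.card_powerset,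
    card_groundSet, ← allFams] at h1
  omega

theorem card_middle_meeting_add {t : ℕ} {Y : Finset ℕ} (hY : Y ⊆ groundSet (2 * t))
    (hcard : Y.card + 1 = t) :
    ((layerEQ (2 * t) t).filter fun X => ¬ Disjoint X Y).card + (t + 1) =
      (2 * t).choose t := by
  have h := Finset.card_filter_add_card_filter_not (s := layerEQ (2 * t) t) (fun X => Disjoint X Y)
  have h' : ((layerEQ (2 * t) t).filter fun X => Disjoint X Y) =
      Finset.powersetCard t (groundSet (2 * t) \ Y) := by
    ext X
    simp only [Finset.mem_filter, mem_layerEQ_iff, Finset.mem_powersetCard, Finset.subset_sdiff]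
    tauto
  have h2 : 2 * t - Y.card = t + 1 := by omega
  rw [h', Finset.card_powersetCard, card_groundSet_sdiff hY, h2, Nat.choose_succ_self_right,
    card_layerEQ] at h
  omega

theorem stmt16 (n t N : ℕ) (ht : 2 ≤ t) (hnt : n = 2 * t)
    (hN1 : 2 ^ (n - 1) < N) (hN2 : N ≤ 2 ^ (n - 1) + n.choose t / 2 - t) :
    ∃ 𝓐 ⊆ allFams n, 𝓐.card = N ∧
      (∀ s, 2 ≤ s → s ≤ N → ∀ 𝓐' ⊆ allFams n, 𝓐'.card = N →
        (interFams s 𝓐').card ≤ (interFams s 𝓐).card) ∧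
      ¬∃ 𝓑 ⊆ layerEQ n t, 𝓐 = layerGE n (t + 1) ∪ 𝓑 := by
  subst hnt
  have h1 : 1 ∈ groundSet (2 * t) := Finset.mem_Icc.2 ⟨le_rfl, by omega⟩
  set Y : Finset ℕ := Finset.Icc 1 (t - 1) with hYdef
  have hY : Y ⊆ groundSet (2 * t) := Finset.Icc_subset_Icc le_rfl (by omega)
  have h1Y : 1 ∈ Y := Finset.mem_Icc.2 ⟨le_rfl, by omega⟩
  have hYcard : Y.card + 1 = t := by
    simp only [hYdef, Nat.card_Icc]
    omega
  have hstar := two_mul_card_middle_star h1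
  have hL := two_mul_card_layerGE_add_choose t
  have hmeet := card_middle_meeting_add hY hYcard
  have hpow : 2 ^ (2 * t) = 2 * 2 ^ (2 * t - 1) := by
    rw [← pow_succ']
    congr 1
    omega
  obtain ⟨B, hB0, hB1, hBcard⟩ := Finset.exists_subsuperset_card_eq
    (s := (layerEQ (2 * t) t).filter fun X => 1 ∈ X)
    (t := (layerEQ (2 * t) t).filter fun X => ¬ Disjoint X Y)
    (n := N - 1 - (layerGE (2 * t) (t + 1)).card)
    (Finset.monotone_filter_right _ fun X _ hX => Finset.not_disjoint_iff.2 ⟨1, hX, h1Y⟩)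
    (by omega) (by omega)
  have hBmem : ∀ X ∈ B, X ⊆ groundSet (2 * t) ∧ X.card = t ∧ ¬ Disjoint X Y := by
    intro X hX
    obtain ⟨h, h'⟩ := Finset.mem_filter.1 (hB1 hX)
    exact ⟨(mem_layerEQ_iff.1 h).1, (mem_layerEQ_iff.1 h).2, h'⟩
  set 𝓐 := layerGE (2 * t) (t + 1) ∪ insert Y B with h𝓐def
  have hmem : ∀ X, X ∈ 𝓐 ↔ (X ⊆ groundSet (2 * t) ∧ t + 1 ≤ X.card) ∨ X = Y ∨ X ∈ B := by
    intro X
    rw [h𝓐def, Finset.mem_union, mem_layerGE_iff, Finset.mem_insert]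
  have h𝓐 : 𝓐 ⊆ allFams (2 * t) := by
    intro X hX
    rw [mem_allFams_iff]
    rcases (hmem X).1 hX with h | rfl | h
    · exact h.1
    · exact hY
    · exact (hBmem X h).1
  have hcard : 𝓐.card = N := by
    have hYB : Y ∉ B := fun h => by
      have := (hBmem Y h).2.1
      omega
    have hdis : Disjoint (layerGE (2 * t) (t + 1)) (insert Y B) := by
      refine Finset.disjoint_left.2 fun X hX hX' => ?_
      have h2 := (mem_layerGE_iff.1 hX).2
      rcases Finset.mem_insert.1 hX' with rfl | h
      · omega
      · have := (hBmem X h).2.1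
        omega
    rw [h𝓐def, Finset.card_union_of_disjoint hdis, Finset.card_insert_of_notMem hYB, hBcard]
    omega
  have hcover : ∀ X ⊆ groundSet (2 * t), X ∈ 𝓐 ∨ groundSet (2 * t) \ X ∈ 𝓐 := by
    intro X hX
    have hc := card_groundSet_sdiff hX
    rcases lt_trichotomy X.card t with h | h | h
    · exact Or.inr ((hmem _).2 (Or.inl ⟨Finset.sdiff_subset, by omega⟩))
    · by_cases hX1 : 1 ∈ X
      · exact Or.inl ((hmem _).2 (Or.inr (Or.inr (hB0
          (Finset.mem_filter.2 ⟨mem_layerEQ_iff.2 ⟨hX, h⟩, hX1⟩)))))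
      · exact Or.inr ((hmem _).2 (Or.inr (Or.inr (hB0
          (Finset.mem_filter.2 ⟨mem_layerEQ_iff.2 ⟨Finset.sdiff_subset, by omega⟩,
            Finset.mem_sdiff.2 ⟨h1, hX1⟩⟩)))))
    · exact Or.inl ((hmem _).2 (Or.inl ⟨hX, h⟩))
  have hdisj : ∀ X ∈ 𝓐, ∀ Z ∈ 𝓐, Disjoint X Z → Z = groundSet (2 * t) \ X := by
    intro X hX Z hZ hXZ
    have hXg := mem_allFams_iff.1 (h𝓐 hX)
    have hZg := mem_allFams_iff.1 (h𝓐 hZ)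
    refine Finset.eq_of_subset_of_card_le (Finset.subset_sdiff.2 ⟨hZg, hXZ.symm⟩) ?_
    rw [card_groundSet_sdiff hXg]
    rcases (hmem X).1 hX with h | rfl | h <;> rcases (hmem Z).1 hZ with h' | rfl | h'
    · omega
    · omega
    · have := (hBmem Z h').2.1
      omega
    · omega
    · exact absurd hXZ (Finset.not_disjoint_iff.2 ⟨1, h1Y, h1Y⟩)
    · exact absurd hXZ.symm (hBmem Z h').2.2
    · have := (hBmem X h).2.1
      omega
    · exact absurd hXZ (hBmem X h).2.2
    · have := (hBmem X h).2.1
      have := (hBmem Z h').2.1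
      omega
  refine ⟨𝓐, h𝓐, hcard, fun s _ _ 𝓐' h𝓐' hcard' =>
    card_interFams_le h1 h𝓐 h𝓐' (hcard'.trans hcard.symm) hcover hdisj s, ?_⟩
  rintro ⟨𝓑, h𝓑, h⟩
  have hY𝓐 : Y ∈ 𝓐 := (hmem Y).2 (Or.inr (Or.inl rfl))
  rw [h, Finset.mem_union, mem_layerGE_iff] at hY𝓐
  rcases hY𝓐 with h' | h'
  · omega
  · have := (mem_layerEQ_iff.1 (h𝓑 h')).2
    omega
end

section
/- Let n ≥ 5 and set i = C(n−1,2). A family 𝓑 ⊆ [n]^(2) with |𝓑| = i maximises the number of intersecting pairs — the number of unordered pairs {B, B'} ⊆ 𝓑 with B ≠ B' and B ∩ B' ≠ ∅ — over all subfamilies of [n]^(2) of size i if and only if there is an element x ∈ [n] such that 𝓑 = {A ∈ [n]^(2) : x ∉ A}. In particular the maximiser is unique up to reordering the coordinates. -/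
open Finset

/-- The number of intersecting pairs in `𝓑`: unordered pairs `{B, B'} ⊆ 𝓑` with
`B ≠ B'` and `B ∩ B' ≠ ∅`. -/
def interPairs (𝓑 : Finset (Finset ℕ)) : ℕ :=
  ((𝓑.powersetCard 2).filter fun P => ∀ B ∈ P, ∀ B' ∈ P, (B ∩ B').Nonempty).card

/-- The number of ordered pairs of disjoint members of `F`. -/
def disjPairs (F : Finset (Finset ℕ)) : ℕ :=
  ∑ A ∈ F, (F.filter fun B => A ∩ B = ∅).card

/-- An intersecting family of at least four pairs is a star. -/
theorem exists_common_mem_of_intersecting {C : Finset (Finset ℕ)} (h2 : ∀ A ∈ C, A.card = 2)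
    (hI : ∀ A ∈ C, ∀ B ∈ C, (A ∩ B).Nonempty) (h4 : 4 ≤ C.card) :
    ∃ x, ∀ A ∈ C, x ∈ A := by
  obtain ⟨P, hP, Q, hQ, hPQ⟩ := Finset.one_lt_card.mp (by omega : 1 < C.card)
  obtain ⟨a, ha⟩ := hI P hP Q hQ
  rw [Finset.mem_inter] at ha
  have key : ∀ R ∈ C, a ∈ R → ∃ b, b ≠ a ∧ R = {a, b} := by
    intro R hR haR
    obtain ⟨u, v, huv, rfl⟩ := Finset.card_eq_two.mp (h2 R hR)
    simp only [Finset.mem_insert, Finset.mem_singleton] at haR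
    rcases haR with rfl | rfl
    · exact ⟨v, huv.symm, rfl⟩
    · exact ⟨u, huv, Finset.pair_comm _ _⟩
  obtain ⟨b, hba, rfl⟩ := key P hP ha.1
  obtain ⟨c, hca, rfl⟩ := key Q hQ ha.2
  have hbc : b ≠ c := fun h => hPQ (by rw [h])
  have off : ∀ R ∈ C, a ∉ R → R = {b, c} := by
    intro R hR haR
    obtain ⟨u, hu⟩ := hI R hR _ hP
    obtain ⟨v, hv⟩ := hI R hR _ hQ
    simp only [Finset.mem_inter, Finset.mem_insert, Finset.mem_singleton] at hu hv
    have hbR : b ∈ R := by grind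
    have hcR : c ∈ R := by grind
    symm
    apply Finset.eq_of_subset_of_card_le
    · intro y hy
      simp only [Finset.mem_insert, Finset.mem_singleton] at hy
      rcases hy with rfl | rfl <;> assumption
    · rw [h2 R hR, Finset.card_pair hbc]
  refine ⟨a, ?_⟩
  by_contra! hne
  obtain ⟨E, hE, haE⟩ := hne
  have hEeq := off E hE haE
  subst hEeq
  have hsub : C ⊆ {{a, b}, {a, c}, {b, c}} := by
    intro R hR
    simp only [Finset.mem_insert, Finset.mem_singleton]
    by_cases haR : a ∈ R
    · obtain ⟨d, hda, rfl⟩ := key R hR haR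
      obtain ⟨u, hu⟩ := hI _ hR _ hE
      simp only [Finset.mem_inter, Finset.mem_insert, Finset.mem_singleton] at hu haE
      have : d = b ∨ d = c := by grind
      rcases this with rfl | rfl <;> simp
    · exact Or.inr (Or.inr (off R hR haR))
  have := (Finset.card_le_card hsub).trans Finset.card_le_three
  omega

theorem two_mul_interPairs_eq_card {F : Finset (Finset ℕ)} (hne : ∀ A ∈ F, A.Nonempty) :
    2 * interPairs F = (F.offDiag.filter fun p => (p.1 ∩ p.2).Nonempty).card := by
  symm
  rw [Finset.card_eq_sum_card_fiberwise (f := fun p : Finset ℕ × Finset ℕ => {p.1, p.2})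
    (t := (F.powersetCard 2).filter fun P => ∀ B ∈ P, ∀ B' ∈ P, (B ∩ B').Nonempty),
    Finset.sum_const_nat (m := 2), interPairs, mul_comm]
  · intro P hP
    simp only [Finset.mem_filter, Finset.mem_powersetCard] at hP
    obtain ⟨⟨hPF, hP2⟩, hPI⟩ := hP
    obtain ⟨A, B, hAB, rfl⟩ := Finset.card_eq_two.mp hP2
    have hA : A ∈ F := hPF (by simp)
    have hB : B ∈ F := hPF (by simp)
    have h1 := hPI A (by simp) B (by simp)
    have h2 := hPI B (by simp) A (by simp)
    have : (((F.offDiag.filter fun p => (p.1 ∩ p.2).Nonempty).filter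
        fun p : Finset ℕ × Finset ℕ => ({p.1, p.2} : Finset (Finset ℕ)) = {A, B})) =
        {(A, B), (B, A)} := by
      ext ⟨X, Y⟩
      simp only [Finset.mem_filter, Finset.mem_offDiag, Finset.mem_insert, Finset.mem_singleton,
        Prod.mk.injEq]
      constructor
      · rintro ⟨-, h⟩
        rw [← Finset.coe_inj] at h
        push_cast at h
        exact Set.pair_eq_pair_iff.mp h
      · rintro (⟨rfl, rfl⟩ | ⟨rfl, rfl⟩)
        · exact ⟨⟨⟨hA, hB, hAB⟩, h1⟩, rfl⟩
        · exact ⟨⟨⟨hB, hA, hAB.symm⟩, h2⟩, Finset.pair_comm _ _⟩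
    rw [this, Finset.card_pair]
    intro h
    exact hAB (Prod.mk.inj h).1
  · rintro ⟨A, B⟩ h
    simp only [Finset.coe_filter, Finset.mem_offDiag, Set.mem_ofPred_eq, ne_eq] at h
    obtain ⟨⟨hA, hB, hAB⟩, hI⟩ := h
    simp only [Finset.coe_filter, Finset.mem_powersetCard, Set.mem_ofPred_eq]
    refine ⟨⟨?_, Finset.card_pair hAB⟩, ?_⟩
    · intro X hX
      simp only [Finset.mem_insert, Finset.mem_singleton] at hX
      rcases hX with rfl | rfl <;> assumption
    · intro X hX Y hY
      simp only [Finset.mem_insert, Finset.mem_singleton] at hX hY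
      rcases hX with rfl | rfl <;> rcases hY with rfl | rfl
      · simpa using hne _ hA
      · exact hI
      · rwa [Finset.inter_comm]
      · simpa using hne _ hB

theorem two_mul_interPairs_add_disjPairs {F : Finset (Finset ℕ)} (hne : ∀ A ∈ F, A.Nonempty) :
    2 * interPairs F + disjPairs F = F.card * F.card - F.card := by
  have hd : disjPairs F = (F.offDiag.filter fun p => ¬ (p.1 ∩ p.2).Nonempty).card := by
    have : (F.offDiag.filter fun p => ¬ (p.1 ∩ p.2).Nonempty) =
        (F ×ˢ F).filter fun p => p.1 ∩ p.2 = ∅ := by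
      ext ⟨A, B⟩
      simp only [Finset.mem_filter, Finset.mem_offDiag, Finset.mem_product,
        Finset.not_nonempty_iff_eq_empty]
      constructor
      · rintro ⟨⟨hA, hB, -⟩, h⟩
        exact ⟨⟨hA, hB⟩, h⟩
      · rintro ⟨⟨hA, hB⟩, h⟩
        refine ⟨⟨hA, hB, ?_⟩, h⟩
        rintro rfl
        rw [Finset.inter_self] at h
        exact (hne _ hA).ne_empty h
    rw [this, Finset.card_filter, Finset.sum_product, disjPairs]
    simp only [Finset.card_filter]
  rw [two_mul_interPairs_eq_card hne, hd, Finset.card_filter_add_card_filter_not,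
    Finset.offDiag_card]

theorem disjPairs_eq_zero_iff {F : Finset (Finset ℕ)} :
    disjPairs F = 0 ↔ ∀ A ∈ F, ∀ B ∈ F, (A ∩ B).Nonempty := by
  simp [disjPairs, Finset.sum_eq_zero_iff, Finset.filter_eq_empty_iff,
    Finset.nonempty_iff_ne_empty]

theorem card_filter_layerEQ_inter_eq_empty {n : ℕ} {A : Finset ℕ} (hA : A ∈ layerEQ n 2) :
    ((layerEQ n 2).filter fun B => A ∩ B = ∅).card = (n - 2).choose 2 := by
  rw [layerEQ, Finset.mem_powersetCard] at hA
  have : ((layerEQ n 2).filter fun B => A ∩ B = ∅) = (groundSet n \ A).powersetCard 2 := by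
    ext B
    simp only [layerEQ, Finset.mem_filter, Finset.mem_powersetCard, Finset.subset_sdiff,
      ← Finset.disjoint_iff_inter_eq_empty, disjoint_comm (a := A)]
    tauto
  rw [this, Finset.card_powersetCard, Finset.card_sdiff_of_subset hA.1, hA.2]
  simp [groundSet]

/-- Passing to the complementary family shifts the number of disjoint pairs by a constant
depending only on the sizes. -/
theorem disjPairs_add_card_sdiff_mul {n : ℕ} {F : Finset (Finset ℕ)} (hF : F ⊆ layerEQ n 2) :
    disjPairs F + (layerEQ n 2 \ F).card * (n - 2).choose 2 =
      disjPairs (layerEQ n 2 \ F) + F.card * (n - 2).choose 2 := by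
  set C := layerEQ n 2 \ F with hC
  have split : ∀ A ∈ layerEQ n 2,
      (F.filter fun B => A ∩ B = ∅).card + (C.filter fun B => A ∩ B = ∅).card =
        (n - 2).choose 2 := by
    intro A hA
    rw [← card_filter_layerEQ_inter_eq_empty hA, ← Finset.card_union_of_disjoint,
      ← Finset.filter_union, hC, Finset.union_sdiff_of_subset hF]
    exact Finset.disjoint_filter_filter Finset.disjoint_sdiff
  have hFsum : disjPairs F + ∑ A ∈ F, (C.filter fun B => A ∩ B = ∅).card =
      F.card * (n - 2).choose 2 := by
    rw [disjPairs, ← Finset.sum_add_distrib]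
    exact Finset.sum_const_nat fun A hA => split A (hF hA)
  have hCsum : ∑ A ∈ C, (F.filter fun B => A ∩ B = ∅).card + disjPairs C =
      C.card * (n - 2).choose 2 := by
    rw [disjPairs, ← Finset.sum_add_distrib]
    exact Finset.sum_const_nat fun A hA => split A (Finset.sdiff_subset hA)
  have hsymm : ∑ A ∈ F, (C.filter fun B => A ∩ B = ∅).card =
      ∑ A ∈ C, (F.filter fun B => A ∩ B = ∅).card := by
    simp only [Finset.card_filter]
    rw [Finset.sum_comm]
    simp only [Finset.inter_comm]
  omega

theorem card_filter_layerEQ_notMem {n x : ℕ} (hx : x ∈ groundSet n) (r : ℕ) :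
    ((layerEQ n r).filter fun A => x ∉ A).card = (n - 1).choose r := by
  have : ((layerEQ n r).filter fun A => x ∉ A) = ((groundSet n).erase x).powersetCard r := by
    ext B
    simp only [layerEQ, Finset.mem_filter, Finset.mem_powersetCard, Finset.subset_erase]
    tauto
  rw [this, Finset.card_powersetCard, Finset.card_erase_of_mem hx]
  simp [groundSet]

theorem disjPairs_sdiff_filter_notMem (n r x : ℕ) :
    disjPairs (layerEQ n r \ (layerEQ n r).filter fun A => x ∉ A) = 0 := by
  rw [disjPairs_eq_zero_iff]
  intro A hA B hB
  simp only [Finset.mem_sdiff, Finset.mem_filter, not_and, not_not] at hA hB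
  exact ⟨x, Finset.mem_inter.mpr ⟨hA.2 hA.1, hB.2 hB.1⟩⟩

/-- Among families of pairs of equal size, having more intersecting pairs amounts to the
complementary family having fewer disjoint pairs. -/
theorem interPairs_le_iff_disjPairs_sdiff_le {n : ℕ} {F G : Finset (Finset ℕ)}
    (hF : F ⊆ layerEQ n 2) (hG : G ⊆ layerEQ n 2) (h : F.card = G.card) :
    interPairs F ≤ interPairs G ↔
      disjPairs (layerEQ n 2 \ G) ≤ disjPairs (layerEQ n 2 \ F) := by
  have hne : ∀ A ∈ layerEQ n 2, A.Nonempty := by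
    intro A hA
    rw [layerEQ, Finset.mem_powersetCard] at hA
    exact Finset.card_pos.mp (by omega)
  have h1 := two_mul_interPairs_add_disjPairs fun A hA => hne A (hF hA)
  have h2 := two_mul_interPairs_add_disjPairs fun A hA => hne A (hG hA)
  have h3 := disjPairs_add_card_sdiff_mul hF
  have h4 := disjPairs_add_card_sdiff_mul hG
  rw [Finset.card_sdiff_of_subset hF, h] at h3
  rw [Finset.card_sdiff_of_subset hG] at h4
  rw [h] at h1
  omega

theorem stmt19 (n : ℕ) (hn : 5 ≤ n)
    (𝓑 : Finset (Finset ℕ)) (h𝓑 : 𝓑 ⊆ layerEQ n 2)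
    (hcard : 𝓑.card = (n - 1).choose 2) :
    (∀ 𝓑' ⊆ layerEQ n 2, 𝓑'.card = (n - 1).choose 2 →
        interPairs 𝓑' ≤ interPairs 𝓑) ↔
      ∃ x ∈ groundSet n, 𝓑 = (layerEQ n 2).filter fun A => x ∉ A := by
  constructor
  · intro hmax
    have h1 : 1 ∈ groundSet n := by
      simp only [groundSet, Finset.mem_Icc]
      omega
    have hle := hmax _ (Finset.filter_subset (fun A => 1 ∉ A) _)
      (card_filter_layerEQ_notMem h1 2)
    rw [interPairs_le_iff_disjPairs_sdiff_le (Finset.filter_subset _ _) h𝓑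
      ((card_filter_layerEQ_notMem h1 2).trans hcard.symm), disjPairs_sdiff_filter_notMem,
      Nat.le_zero, disjPairs_eq_zero_iff] at hle
    have hC : 4 ≤ (layerEQ n 2 \ 𝓑).card := by
      rw [Finset.card_sdiff_of_subset h𝓑, hcard, layerEQ, Finset.card_powersetCard]
      obtain ⟨m, rfl⟩ : ∃ m, n = m + 1 := ⟨n - 1, by omega⟩
      have := Nat.choose_succ_succ' m 1
      simp only [groundSet, Nat.card_Icc, Nat.add_sub_cancel, Nat.choose_one_right,
        Nat.reduceAdd] at this ⊢
      omega
    have hmem : ∀ A ∈ layerEQ n 2 \ 𝓑, A ⊆ groundSet n ∧ A.card = 2 := fun A hA =>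
      Finset.mem_powersetCard.mp (Finset.sdiff_subset hA)
    obtain ⟨x, hx⟩ := exists_common_mem_of_intersecting (fun A hA => (hmem A hA).2) hle hC
    obtain ⟨A, hA⟩ := Finset.card_pos.mp (by omega : 0 < (layerEQ n 2 \ 𝓑).card)
    have hxn : x ∈ groundSet n := (hmem A hA).1 (hx A hA)
    refine ⟨x, hxn, (Finset.eq_of_subset_of_card_le ?_ ?_).symm⟩
    · intro B hB
      rw [Finset.mem_filter] at hB
      by_contra hB'
      exact hB.2 (hx B (Finset.mem_sdiff.mpr ⟨hB.1, hB'⟩))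
    · rw [card_filter_layerEQ_notMem hxn, hcard]
  · rintro ⟨x, -, rfl⟩ 𝓑' h𝓑' hcard'
    rw [interPairs_le_iff_disjPairs_sdiff_le h𝓑' h𝓑 (hcard'.trans hcard.symm),
      disjPairs_sdiff_filter_notMem]
    exact Nat.zero_le _
end
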